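/- For all integers r ≥ 1 and all integers n, Σ_{k=0}^{r} 𝒞_k(q) · Σ_{m=0}^{r-k} (1-q)^m · binom(n-2k-m, r-k-m) · binom(k+m, m) = binom(n+1, r), as an identity of polynomials in q, where 𝒞_k denotes the large Narayana polynomial and, for an integer a and a natural number j, binom(a,j) = a(a-1)···(a-j+1)/j! is the generalized binomial coefficient. -/

import Mathlib

open Polynomial Finset

/-- The Narayana polynomial `C_n(q)`. -/
noncomputable def narayana (n : ℕ) : Polynomial ℚ :=
  if n = 0 then 1
  else ∑ k ∈ Finset.Icc 1 n,
    Polynomial.C ((n.choose (k - 1) * n.choose k : ℚ) / n) * Polynomial.X ^ (k - 1)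

/-- The large Narayana polynomial `𝒞_0 = 1`, `𝒞_n(q) = q·C_n(q)` for `n ≥ 1`. -/
noncomputable def largeNarayana (n : ℕ) : Polynomial ℚ :=
  if n = 0 then 1 else Polynomial.X * narayana n

/-- The generalized binomial coefficient `binom(a,j) = a(a-1)⋯(a-j+1)/j!` for `a : ℤ`. -/
def gchoose (a : ℤ) (j : ℕ) : ℚ :=
  (∏ i ∈ Finset.range j, ((a : ℚ) - i)) / (Nat.factorial j)

lemma gchoose_zero (a : ℤ) : gchoose a 0 = 1 := by simp [gchoose]

lemma gchoose_succ_succ (a : ℤ) (j : ℕ) :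
    gchoose (a + 1) (j + 1) = gchoose a (j + 1) + gchoose a j := by
  have h : ∏ i ∈ range (j + 1), (((a + 1 : ℤ) : ℚ) - i) =
      (∏ i ∈ range j, ((a : ℚ) - i)) * (a + 1) := by
    rw [prod_range_succ']
    push_cast
    congr 1
    · exact prod_congr rfl fun i _ => by ring
    · ring
  have hj : (j.factorial : ℚ) ≠ 0 := by positivity
  simp only [gchoose]
  rw [h, prod_range_succ, Nat.factorial_succ]
  push_cast
  field_simp
  ring

lemma gchoose_sub_one_sub (k j : ℕ) :
    gchoose ((j : ℤ) - 1 - k) j = (-1) ^ j * (k.choose j : ℚ) := by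
  have h : ∏ i ∈ range j, ((((j : ℤ) - 1 - k : ℤ) : ℚ) - i) =
      (-1) ^ j * (k.descFactorial j : ℚ) := by
    rw [← prod_range_reflect, ← descPochhammer_eval_eq_descFactorial, descPochhammer_eval_eq_prod_range]
    have h1 : ((-1 : ℚ)) ^ j = ∏ _i ∈ range j, (-1 : ℚ) := by simp
    rw [h1, ← prod_mul_distrib]
    refine prod_congr rfl fun i hi => ?_
    have hi' : i + 1 ≤ j := mem_range.mp hi
    rw [Nat.sub_sub, Nat.cast_sub (by omega)]
    push_cast
    ring
  have hj : (j.factorial : ℚ) ≠ 0 := by positivity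
  rw [gchoose, h, Nat.descFactorial_eq_factorial_mul_choose]
  push_cast
  field_simp

lemma coeff_narayana_succ (n j : ℕ) :
    (narayana (n + 1)).coeff j = ((n + 1).choose j * (n + 1).choose (j + 1) : ℚ) / (n + 1) := by
  rw [narayana, if_neg n.succ_ne_zero, finsetSum_coeff]
  simp only [coeff_C_mul, coeff_X_pow]
  rw [sum_eq_single (j + 1)]
  · simp
  · intro b hb hne
    rw [if_neg (by rw [mem_Icc] at hb; omega), mul_zero]
  · intro hj
    have : n + 1 < j + 1 := by rw [mem_Icc] at hj; omega
    simp [Nat.choose_eq_zero_of_lt this]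

lemma cast_choose_succ (n k : ℕ) :
    (n.choose (k + 1) : ℚ) = n.choose k * ((n : ℚ) - k) / (k + 1) := by
  have h := Nat.choose_succ_right_eq n k
  rcases le_or_gt k n with hk | hk
  · rw [eq_div_iff (by positivity), ← Nat.cast_sub hk]
    exact_mod_cast h
  · simp [Nat.choose_eq_zero_of_lt hk, Nat.choose_eq_zero_of_lt (hk.trans k.lt_succ_self)]

lemma narayana_recurrence (n : ℕ) :
    ((n : ℚ[X]) + 3) * narayana (n + 2) =
      (2 * (n : ℚ[X]) + 3) * (1 + X) * narayana (n + 1) - (n : ℚ[X]) * (1 - X) ^ 2 * narayana n := by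
  have hn : (n : ℚ[X]) * narayana n =
      C (n : ℚ) * narayana n := by simp
  have hc : ∀ j, ((n : ℚ[X]) * narayana n).coeff j = (n.choose j * n.choose (j + 1) : ℚ) := by
    intro j
    cases n with
    | zero => simp
    | succ n =>
      rw [hn, coeff_C_mul, coeff_narayana_succ]
      push_cast
      field_simp
  have e1 : ((n : ℚ[X]) + 3) * narayana (n + 2) = C ((n : ℚ) + 3) * narayana (n + 2) := by
    rw [C_add, map_natCast, map_ofNat]
  have e2 : (2 * (n : ℚ[X]) + 3) * (1 + X) * narayana (n + 1) - (n : ℚ[X]) * (1 - X) ^ 2 * narayana n =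
      C (2 * (n : ℚ) + 3) * (narayana (n + 1) + X * narayana (n + 1)) -
       ((n : ℚ[X]) * narayana n - C 2 * (X * ((n : ℚ[X]) * narayana n)) +
        X * (X * ((n : ℚ[X]) * narayana n))) := by
    simp only [C_add, C_mul, map_natCast, map_ofNat]
    ring
  rw [e1, e2]
  ext j
  rcases j with _ | _ | j
  · simp only [coeff_sub, coeff_add, coeff_C_mul, coeff_X_mul_zero, hc,
      coeff_narayana_succ]
    simp
    field_simp
    ring
  · simp only [coeff_sub, coeff_add, coeff_C_mul, coeff_X_mul, coeff_X_mul_zero, hc,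
      coeff_narayana_succ, Nat.choose_succ_succ, cast_choose_succ, Nat.cast_add]
    simp
    field_simp
    ring
  · simp only [coeff_sub, coeff_add, coeff_C_mul, coeff_X_mul, hc,
      coeff_narayana_succ, Nat.choose_succ_succ, cast_choose_succ, Nat.cast_add]
    push_cast
    field_simp
    ring

lemma largeNarayana_zero : largeNarayana 0 = 1 := by simp [largeNarayana]

lemma largeNarayana_one : largeNarayana 1 = X := by simp [largeNarayana, narayana]

lemma largeNarayana_recurrence (n : ℕ) :
    ((n : ℚ[X]) + 3) * largeNarayana (n + 2) =
      (2 * (n : ℚ[X]) + 3) * (1 + X) * largeNarayana (n + 1) -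
        (n : ℚ[X]) * (1 - X) ^ 2 * largeNarayana n := by
  have h : (n : ℚ[X]) * largeNarayana n = (n : ℚ[X]) * (X * narayana n) := by
    cases n <;> simp [largeNarayana]
  have h1 : largeNarayana (n + 1) = X * narayana (n + 1) := by simp [largeNarayana]
  have h2 : largeNarayana (n + 2) = X * narayana (n + 2) := by simp [largeNarayana]
  rw [h1, h2]
  linear_combination X * narayana_recurrence n + (1 - X) ^ 2 * h

/-- The generating function of the large Narayana polynomials evaluated at `q`. -/
noncomputable def largeNarayanaSeries (q : ℚ) : PowerSeries ℚ :=
  PowerSeries.mk fun k => (largeNarayana k).eval q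

lemma eq_zero_of_mul_derivative_eq {Δ E : PowerSeries ℚ}
    (hΔ : PowerSeries.constantCoeff Δ ≠ 0) (hE : PowerSeries.constantCoeff E = 0)
    (h : Δ * PowerSeries.derivative ℚ E = PowerSeries.derivative ℚ Δ * E) : E = 0 := by
  have hinv : Δ * Δ⁻¹ = 1 := PowerSeries.mul_inv_cancel _ hΔ
  have h0 : E * Δ⁻¹ = 0 := by
    refine PowerSeries.derivative.ext ?_ ?_
    · rw [Derivation.leibniz, PowerSeries.derivative_inv']
      simp only [smul_eq_mul, map_zero]
      linear_combination Δ⁻¹ ^ 2 * h - PowerSeries.derivative ℚ E * Δ⁻¹ * hinv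
    · simp [hE]
  calc E = E * Δ⁻¹ * Δ := by linear_combination -E * hinv
    _ = 0 := by rw [h0, zero_mul]

lemma largeNarayanaSeries_derivative (q : ℚ) :
    let D : PowerSeries ℚ := 2 * PowerSeries.X * largeNarayanaSeries q
      - PowerSeries.C (1 - q) * PowerSeries.X - 1
    PowerSeries.derivative ℚ D - PowerSeries.C (2 * (1 + q)) *
        (PowerSeries.X * PowerSeries.derivative ℚ D) +
        PowerSeries.C ((1 - q) ^ 2) * (PowerSeries.X * (PowerSeries.X * PowerSeries.derivative ℚ D)) =
      PowerSeries.C ((1 - q) ^ 2) * (PowerSeries.X * D) - PowerSeries.C (1 + q) * D := by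
  intro D
  have h0 : PowerSeries.coeff 0 D = -1 := by simp [D]
  have hD : D = PowerSeries.C 2 * (PowerSeries.X * largeNarayanaSeries q)
      - PowerSeries.C (1 - q) * PowerSeries.X - 1 := by
    simp only [D, map_ofNat]; ring
  have h1 : PowerSeries.coeff 1 D = 1 + q := by
    rw [hD]
    simp only [map_sub, PowerSeries.coeff_C_mul,
      PowerSeries.coeff_succ_X_mul, largeNarayanaSeries, PowerSeries.coeff_mk, largeNarayana_zero,
      PowerSeries.coeff_one, eval_one]
    norm_num
    ring
  have h2 : ∀ n, PowerSeries.coeff (n + 2) D = 2 * (largeNarayana (n + 1)).eval q := by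
    intro n
    rw [hD]
    simp only [map_sub, PowerSeries.coeff_C_mul,
      PowerSeries.coeff_succ_X_mul, largeNarayanaSeries, PowerSeries.coeff_mk,
      PowerSeries.coeff_one]
    simp
  clear_value D
  generalize hb : 1 + q = b at h1 ⊢
  generalize hc : (1 - q) ^ 2 = c
  ext n
  rcases n with _ | _ | _ | n
  · simp only [map_sub, map_add, PowerSeries.coeff_C_mul, PowerSeries.coeff_zero_X_mul,
      PowerSeries.coeff_derivative, zero_add, h0, h1]
    simp
  · simp only [map_sub, map_add, PowerSeries.coeff_C_mul, PowerSeries.coeff_zero_X_mul,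
      PowerSeries.coeff_succ_X_mul, PowerSeries.coeff_derivative, zero_add, h0, h1, h2]
    subst hb hc
    simp [largeNarayana_one]
    ring
  · have h := congrArg (eval q) (largeNarayana_recurrence 0)
    simp only [map_sub, map_add, PowerSeries.coeff_C_mul,
      PowerSeries.coeff_succ_X_mul, PowerSeries.coeff_derivative, zero_add, h1, h2]
    subst hb hc
    simp at h ⊢
    linear_combination 2 * h
  · have h := congrArg (eval q) (largeNarayana_recurrence (n + 1))
    simp only [map_sub, map_add, PowerSeries.coeff_C_mul,
      PowerSeries.coeff_succ_X_mul, PowerSeries.coeff_derivative, h2]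
    subst hb hc
    simp at h ⊢
    linear_combination 2 * h

lemma largeNarayanaSeries_quadratic (q : ℚ) :
    largeNarayanaSeries q = 1 + PowerSeries.X * largeNarayanaSeries q *
      (largeNarayanaSeries q - PowerSeries.C (1 - q)) := by
  have h := largeNarayanaSeries_derivative q
  set S := largeNarayanaSeries q
  set D : PowerSeries ℚ := 2 * PowerSeries.X * S
      - PowerSeries.C (1 - q) * PowerSeries.X - 1 with hD
  simp only at h
  set Δ : PowerSeries ℚ := 1 - PowerSeries.C (2 * (1 + q)) * PowerSeries.X +
    PowerSeries.C ((1 - q) ^ 2) * PowerSeries.X ^ 2 with hΔ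
  have hΔ' : PowerSeries.derivative ℚ Δ =
      2 * PowerSeries.C ((1 - q) ^ 2) * PowerSeries.X - PowerSeries.C (2 * (1 + q)) := by
    rw [hΔ]
    simp only [map_add, map_sub, Derivation.leibniz, PowerSeries.derivative_C,
      PowerSeries.derivative_X, PowerSeries.derivative_pow, smul_eq_mul, PowerSeries.derivative_one]
    push_cast
    ring
  have hC : (PowerSeries.C (2 * (1 + q)) : PowerSeries ℚ) = 2 * PowerSeries.C (1 + q) := by
    simp only [map_mul, map_ofNat]
  have hE : D ^ 2 - Δ = 0 := by
    refine eq_zero_of_mul_derivative_eq (Δ := Δ) ?_ ?_ ?_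
    · simp [hΔ]
    · simp [hΔ, hD]
    · rw [map_sub, PowerSeries.derivative_pow, hΔ', hΔ]
      rw [hC] at h ⊢
      push_cast
      linear_combination 2 * D * h
  have hX : (4 * PowerSeries.X : PowerSeries ℚ) ≠ 0 :=
    by
    refine mul_ne_zero (fun h4 => ?_) PowerSeries.X_ne_zero
    rw [← map_ofNat (PowerSeries.C (R := ℚ)) 4] at h4
    simpa using congrArg PowerSeries.constantCoeff h4
  refine mul_left_cancel₀ hX ?_
  simp only [hD, hΔ] at hE
  simp only [map_mul, map_add, map_sub, map_pow, map_one, map_ofNat] at hE ⊢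
  linear_combination -hE

lemma coeff_one_sub_X_pow (k j : ℕ) :
    PowerSeries.coeff j ((1 - PowerSeries.X : PowerSeries ℚ) ^ k) = (-1) ^ j * (k.choose j : ℚ) := by
  have h : (1 - PowerSeries.X : PowerSeries ℚ) =
      PowerSeries.rescale (-1) ((1 + X : ℚ[X]) : PowerSeries ℚ) := by
    simp [PowerSeries.rescale_X, sub_eq_add_neg]
  rw [h, ← map_pow, PowerSeries.coeff_rescale, ← Polynomial.coe_pow, Polynomial.coeff_coe,
    Polynomial.coeff_one_add_X_pow]

/-- The geometric series `1 / (1 - a x)`. -/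
noncomputable def geomSeries (a : ℚ) : PowerSeries ℚ :=
  PowerSeries.rescale a (PowerSeries.mk 1)

lemma geomSeries_mul (a : ℚ) :
    geomSeries a * (1 - PowerSeries.C a * PowerSeries.X) = 1 := by
  have h := congrArg (PowerSeries.rescale a) (PowerSeries.mk_one_mul_one_sub_eq_one ℚ)
  simpa [geomSeries, PowerSeries.rescale_X] using h

lemma coeff_geomSeries_pow (a : ℚ) (k m : ℕ) :
    PowerSeries.coeff m (geomSeries a ^ (k + 1)) = a ^ m * ((k + m).choose m : ℚ) := by
  rw [geomSeries, ← map_pow, PowerSeries.mk_one_pow_eq_mk_choose_add, PowerSeries.coeff_rescale,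
    PowerSeries.coeff_mk, Nat.choose_symm_add]

lemma subst_largeNarayanaSeries (q : ℚ) :
    (largeNarayanaSeries q).subst
        (PowerSeries.X * ((1 - PowerSeries.X) * geomSeries (1 - q)) : PowerSeries ℚ) *
      geomSeries (1 - q) = PowerSeries.mk 1 := by
  set a := 1 - q
  set y : PowerSeries ℚ := PowerSeries.X * ((1 - PowerSeries.X) * geomSeries a) with hy
  have hs : PowerSeries.HasSubst y := PowerSeries.HasSubst.of_constantCoeff_zero' (by simp [hy])
  set G := (largeNarayanaSeries q).subst y
  have hG : G = 1 + y * G * (G - PowerSeries.C a) := by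
    have h := congrArg (PowerSeries.substAlgHom hs) (largeNarayanaSeries_quadratic q)
    have hC : PowerSeries.substAlgHom hs (PowerSeries.C a) = PowerSeries.C a :=
      (PowerSeries.substAlgHom hs).commutes a
    rw [map_add, map_mul, map_mul, map_sub, map_one, hC, PowerSeries.substAlgHom_X,
      PowerSeries.coe_substAlgHom] at h
    exact h
  have hv := geomSeries_mul a
  have hw := PowerSeries.mk_one_mul_one_sub_eq_one ℚ
  set v := geomSeries a
  set w : PowerSeries ℚ := PowerSeries.mk 1
  set H : PowerSeries ℚ := (1 - PowerSeries.C a * PowerSeries.X) * w with hH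
  have hyH : y * H = PowerSeries.X := by
    rw [hy, hH]
    linear_combination PowerSeries.X * (1 - PowerSeries.X) * w * hv + PowerSeries.X * hw
  have hHq : H = 1 + y * H * (H - PowerSeries.C a) := by
    rw [hyH, hH]
    linear_combination (1 - PowerSeries.X * PowerSeries.C a) * hw
  have hprod : (G - H) * (1 - y * (G + H - PowerSeries.C a)) = 0 := by
    linear_combination hG - hHq
  have hne : (1 - y * (G + H - PowerSeries.C a)) ≠ 0 := by
    intro h
    simpa [hy] using congrArg PowerSeries.constantCoeff h
  have hGH : G = H := sub_eq_zero.mp ((mul_eq_zero.mp hprod).resolve_right hne)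
  rw [hGH, hH]
  linear_combination w * hv

lemma sum_largeNarayana_alternating (q : ℚ) (r : ℕ) :
    ∑ k ∈ range (r + 1), (largeNarayana k).eval q *
      ∑ m ∈ range (r - k + 1), (1 - q) ^ m *
        ((-1) ^ (r - k - m) * (k.choose (r - k - m) : ℚ) * ((k + m).choose m : ℚ)) = 1 := by
  have h := congrArg (PowerSeries.coeff r) (subst_largeNarayanaSeries q)
  set a := 1 - q
  set y : PowerSeries ℚ := PowerSeries.X * ((1 - PowerSeries.X) * geomSeries a) with hy
  have hs : PowerSeries.HasSubst y := PowerSeries.HasSubst.of_constantCoeff_zero' (by simp [hy])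
  obtain ⟨R, hR⟩ : ∃ R : PowerSeries ℚ, (largeNarayanaSeries q).subst y = y ^ (r + 1) * R +
      ∑ k ∈ range (r + 1), PowerSeries.C ((largeNarayana k).eval q) * y ^ k := by
    have h1 := PowerSeries.eq_X_pow_mul_shift_add_trunc (r + 1) (largeNarayanaSeries q)
    have h2 := congrArg (PowerSeries.substAlgHom hs) h1
    rw [map_add, map_mul, map_pow, PowerSeries.substAlgHom_X, PowerSeries.substAlgHom_coe,
      PowerSeries.coe_substAlgHom] at h2
    refine ⟨PowerSeries.subst y (PowerSeries.mk fun i =>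
      PowerSeries.coeff (i + (r + 1)) (largeNarayanaSeries q)), h2.trans ?_⟩
    congr 1
    rw [PowerSeries.trunc_apply, map_sum, ← range_eq_Ico]
    refine sum_congr rfl fun k _ => ?_
    rw [Polynomial.aeval_monomial]
    simp [largeNarayanaSeries]
  rw [hR, add_mul, map_add] at h
  have hlow : PowerSeries.coeff r (y ^ (r + 1) * R * geomSeries a) = 0 := by
    rw [hy, mul_pow, mul_assoc, mul_assoc, PowerSeries.coeff_X_pow_mul', if_neg (by omega)]
  rw [hlow, zero_add, sum_mul, map_sum] at h
  simp only [PowerSeries.coeff_mk, Pi.one_apply] at h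
  refine Eq.trans ?_ h
  refine sum_congr rfl fun k hk => ?_
  have hkr : k ≤ r := by have := mem_range.mp hk; omega
  have e : PowerSeries.C ((largeNarayana k).eval q) * y ^ k * geomSeries a =
      PowerSeries.C ((largeNarayana k).eval q) * (PowerSeries.X ^ k *
        (geomSeries a ^ (k + 1) * (1 - PowerSeries.X) ^ k)) := by
    rw [hy, mul_pow, mul_pow, pow_succ]
    ring
  rw [e, PowerSeries.coeff_C_mul, PowerSeries.coeff_X_pow_mul', if_pos hkr, PowerSeries.coeff_mul,
    Nat.sum_antidiagonal_eq_sum_range_succ_mk]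
  congr 1
  refine sum_congr rfl fun m _ => ?_
  rw [coeff_geomSeries_pow, coeff_one_sub_X_pow]
  ring

/-- The left-hand side of Jonah's formula, evaluated at `q`. -/
noncomputable def jonahSum (q : ℚ) (r : ℕ) (n : ℤ) : ℚ :=
  ∑ k ∈ range (r + 1), (largeNarayana k).eval q *
    ∑ m ∈ range (r - k + 1), (1 - q) ^ m *
      (gchoose (n - 2 * k - m) (r - k - m) * ((k + m).choose m : ℚ))

lemma jonahSum_self (q : ℚ) (r : ℕ) : jonahSum q r ((r : ℤ) - 1) = 1 := by
  rw [← sum_largeNarayana_alternating q r, jonahSum]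
  refine sum_congr rfl fun k hk => ?_
  congr 1
  refine sum_congr rfl fun m hm => ?_
  rw [mem_range] at hk hm
  have e : (r : ℤ) - 1 - 2 * k - m = ((r - k - m : ℕ) : ℤ) - 1 - k := by omega
  rw [e, gchoose_sub_one_sub]

lemma jonahSum_succ (q : ℚ) (r : ℕ) (n : ℤ) :
    jonahSum q (r + 1) (n + 1) = jonahSum q (r + 1) n + jonahSum q r n := by
  rw [jonahSum, jonahSum, jonahSum, sum_range_succ, sum_range_succ _ (r + 1),
    add_right_comm, ← sum_add_distrib]
  congr 1
  · refine sum_congr rfl fun k hk => ?_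
    have hkr : k ≤ r := by have := mem_range.mp hk; omega
    rw [← mul_add, show r + 1 - k + 1 = (r - k + 1) + 1 by omega, sum_range_succ,
      sum_range_succ _ (r - k + 1), add_right_comm, ← sum_add_distrib]
    congr 2
    · refine sum_congr rfl fun m hm => ?_
      have hm' : m ≤ r - k := by have := mem_range.mp hm; omega
      rw [show r + 1 - k - m = (r - k - m) + 1 by omega,
        show n + 1 - 2 * (k : ℤ) - m = (n - 2 * k - m) + 1 by ring, gchoose_succ_succ]
      ring
    · rw [show r + 1 - k - (r - k + 1) = 0 by omega, gchoose_zero, gchoose_zero]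
  · simp [gchoose_zero]

lemma gchoose_self (r : ℕ) : gchoose r r = 1 := by
  induction r with
  | zero => exact gchoose_zero _
  | succ r ih =>
    have h1 := gchoose_sub_one_sub 0 (r + 1)
    push_cast at h1 ⊢
    rw [gchoose_succ_succ, ih]
    simp at h1
    simpa using h1

lemma jonahSum_eq (q : ℚ) (r : ℕ) (n : ℤ) : jonahSum q r n = gchoose (n + 1) r := by
  induction r generalizing n with
  | zero => simp [jonahSum, gchoose_zero, largeNarayana_zero]
  | succ r ih =>
    induction n using Int.inductionOn' (b := (r : ℤ)) with
    | zero =>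
      have h := jonahSum_self q (r + 1)
      have h' := gchoose_self (r + 1)
      push_cast at h h'
      rw [add_sub_cancel_right] at h
      rw [h, h']
    | succ n _ hn => rw [jonahSum_succ, hn, ih, gchoose_succ_succ (n + 1)]
    | pred n _ hn =>
      have h := jonahSum_succ q r (n - 1)
      have h' := gchoose_succ_succ n r
      rw [sub_add_cancel, hn, ih, sub_add_cancel] at h
      rw [sub_add_cancel]
      linarith

/-- Second generalization of Jonah's formula, for large Narayana polynomials. -/
theorem narayana_jonah_second (r : ℕ) (hr : 1 ≤ r) (n : ℤ) :
    ∑ k ∈ Finset.range (r + 1),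
      largeNarayana k *
        ∑ m ∈ Finset.range (r - k + 1),
          (1 - Polynomial.X) ^ m *
            Polynomial.C (gchoose (n - 2 * k - m) (r - k - m) * ((k + m).choose m : ℚ)) =
      Polynomial.C (gchoose (n + 1) r) := by
  refine Polynomial.funext fun q => ?_
  rw [eval_C, ← jonahSum_eq q r n, jonahSum]
  simp only [eval_finsetSum, eval_mul, eval_pow, eval_sub, eval_one, eval_X, eval_C]
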